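/- Let f_1, f_2, f_3, f_4 be nonzero pairwise non-proportional binary quadratic forms over ℂ and λ_1, …, λ_4 nonzero complex scalars with λ_1 f_1^5 + λ_2 f_2^5 + λ_3 f_3^5 + λ_4 f_4^5 = 0. Define q_k(x,y) = i^k x² + √(−2) x y + i^{−k} y² for k = 0,1,2,3 (which satisfy Σ_{k=0}^{3} (−1)^k q_k^5 = 0). Then {f_1,…,f_4} is a cousin of {q_0, q_1, q_2, q_3}: there exist an invertible linear change of variables M: (x,y) ↦ (αx+βy, γx+δy) with αδ−βγ ≠ 0, a permutation π of {1,2,3,4}, and nonzero constants c_1,…,c_4 ∈ ℂ such that f_j(x,y) = c_j · q_{π(j)}(αx+βy, γx+δy) for j = 1,…,4. -/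

import Mathlib

open MvPolynomial Finset

/-- The variable `x` in `ℂ[x,y]`. -/
noncomputable def Px : MvPolynomial (Fin 2) ℂ := MvPolynomial.X 0

/-- The variable `y` in `ℂ[x,y]`. -/
noncomputable def Py : MvPolynomial (Fin 2) ℂ := MvPolynomial.X 1

/-- The substitution `(x,y) ↦ (αx + βy, γx + δy)` applied to a binary form. -/
noncomputable def linChange (a b c d : ℂ) (g : MvPolynomial (Fin 2) ℂ) :
    MvPolynomial (Fin 2) ℂ :=
  MvPolynomial.aeval ![C a * Px + C b * Py, C c * Px + C d * Py] g

/-- The quadratic forms `q_k = i^k x² + √(−2) xy + i^{−k} y²` for `k = 0,1,2,3`. -/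
noncomputable def quinticForm : Fin 4 → MvPolynomial (Fin 2) ℂ := fun k =>
  C (Complex.I ^ (k : ℕ)) * Px ^ 2 +
    C (Complex.I * (Real.sqrt 2 : ℂ)) * Px * Py +
    C (Complex.I⁻¹ ^ (k : ℕ)) * Py ^ 2

/-- Four pairwise non-proportional linear forms have linearly independent fifth powers. -/
lemma false_of_fifth_powers_of_four_linear_forms (u v l : Fin 4 → ℂ)
    (huv : ∀ i j, i ≠ j → u i * v j - v i * u j ≠ 0) (hl : l 0 ≠ 0)
    (h0 : ∑ j, l j * u j ^ 5 = 0) (h1 : ∑ j, l j * (u j ^ 4 * v j) = 0)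
    (h2 : ∑ j, l j * (u j ^ 3 * v j ^ 2) = 0) (h3 : ∑ j, l j * (u j ^ 2 * v j ^ 3) = 0)
    (h4 : ∑ j, l j * (u j * v j ^ 4) = 0) (h5 : ∑ j, l j * v j ^ 5 = 0) : False := by
  have n1 := huv 0 1 (by decide)
  have n2 := huv 0 2 (by decide)
  have n3 := huv 0 3 (by decide)
  simp only [Fin.sum_univ_four] at h0 h1 h2 h3 h4 h5
  have key : (u 0 * v 1 - v 0 * u 1) * (u 0 * v 2 - v 0 * u 2) * (u 0 * v 3 - v 0 * u 3) ≠ 0 :=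
    mul_ne_zero (mul_ne_zero n1 n2) n3
  have hu : l 0 * u 0 ^ 2 *
      ((u 0 * v 1 - v 0 * u 1) * (u 0 * v 2 - v 0 * u 2) * (u 0 * v 3 - v 0 * u 3)) = 0 := by
    linear_combination (v 1 * v 2 * v 3) * h0
      - (u 1 * v 2 * v 3 + v 1 * u 2 * v 3 + v 1 * v 2 * u 3) * h1
      + (u 1 * u 2 * v 3 + u 1 * v 2 * u 3 + v 1 * u 2 * u 3) * h2 - u 1 * u 2 * u 3 * h3
  have hv : l 0 * v 0 ^ 2 *
      ((u 0 * v 1 - v 0 * u 1) * (u 0 * v 2 - v 0 * u 2) * (u 0 * v 3 - v 0 * u 3)) = 0 := by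
    linear_combination (v 1 * v 2 * v 3) * h2
      - (u 1 * v 2 * v 3 + v 1 * u 2 * v 3 + v 1 * v 2 * u 3) * h3
      + (u 1 * u 2 * v 3 + u 1 * v 2 * u 3 + v 1 * u 2 * u 3) * h4 - u 1 * u 2 * u 3 * h5
  have hu0 : u 0 = 0 := by simpa [hl, key] using hu
  have hv0 : v 0 = 0 := by simpa [hl, key] using hv
  exact n1 (by rw [hu0, hv0]; ring)

/-- The odd parts in `x` of the fifth powers of `a x² + xy + c y²` and `a' x² + xy + c' y²` are
proportional only if the forms are equal, are flips of each other, or lie in the special family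
`a c = -1/2`. -/
lemma odd_part_fifth_power_trichotomy {a c a' c' l l' : ℂ} (hl : l ≠ 0) (hl' : l' ≠ 0)
    (e1 : l * c ^ 4 + l' * c' ^ 4 = 0)
    (e3 : l * (2 * a * c ^ 3 + c ^ 2) + l' * (2 * a' * c' ^ 3 + c' ^ 2) = 0)
    (e5 : l * (30 * a ^ 2 * c ^ 2 + 20 * a * c + 1)
      + l' * (30 * a' ^ 2 * c' ^ 2 + 20 * a' * c' + 1) = 0)
    (e7 : l * (2 * a ^ 3 * c + a ^ 2) + l' * (2 * a' ^ 3 * c' + a' ^ 2) = 0)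
    (e9 : l * a ^ 4 + l' * a' ^ 4 = 0) :
    (a' = a ∧ c' = c) ∨ (l' = -l ∧ a' = -a ∧ c' = -c) ∨
      (l' = -l ∧ a * c = -1 / 2 ∧ ∃ ε : ℂ, ε ^ 2 = -1 ∧ a' = ε * a ∧ c' = -ε * c) := by
  by_cases ha : a = 0
  · subst ha
    have ha' : a' = 0 := by simpa [hl'] using e9
    subst ha'
    have hll : l' = -l := by linear_combination e5
    subst hll
    have hc : (c' - c) * (c' + c) = 0 := by
      apply mul_left_cancel₀ hl
      linear_combination -e3
    rcases mul_eq_zero.1 hc with h | h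
    · exact Or.inl ⟨rfl, by linear_combination h⟩
    · exact Or.inr (Or.inl ⟨rfl, by simp, by linear_combination h⟩)
  by_cases hc : c = 0
  · subst hc
    have hc' : c' = 0 := by simpa [hl'] using e1
    subst hc'
    have hll : l' = -l := by linear_combination e5
    subst hll
    have h : (a' - a) * (a' + a) = 0 := by
      apply mul_left_cancel₀ hl
      linear_combination -e7
    rcases mul_eq_zero.1 h with h | h
    · exact Or.inl ⟨by linear_combination h, rfl⟩
    · exact Or.inr (Or.inl ⟨rfl, by linear_combination h, by simp⟩)
  obtain ⟨α, rfl⟩ : ∃ α, a' = α * a := ⟨a' / a, by field_simp⟩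
  obtain ⟨γ, rfl⟩ : ∃ γ, c' = γ * c := ⟨c' / c, by field_simp⟩
  have hlα : l = -l' * α ^ 4 := by
    apply mul_right_cancel₀ (pow_ne_zero 4 ha)
    linear_combination e9
  have hlγ : l = -l' * γ ^ 4 := by
    apply mul_right_cancel₀ (pow_ne_zero 4 hc)
    linear_combination e1
  have hα : α ≠ 0 := by rintro rfl; simp at hlα; exact hl hlα
  have hγ : γ ≠ 0 := by rintro rfl; simp at hlγ; exact hl hlγ
  have k7 : α ^ 2 * (2 * (a * c) + 1) = 2 * α * γ * (a * c) + 1 := by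
    apply mul_left_cancel₀ (mul_ne_zero hl' (mul_ne_zero (pow_ne_zero 2 hα) (pow_ne_zero 2 ha)))
    linear_combination -e7 + (2 * a ^ 3 * c + a ^ 2) * hlα
  have k3 : γ ^ 2 * (2 * (a * c) + 1) = 2 * α * γ * (a * c) + 1 := by
    apply mul_left_cancel₀ (mul_ne_zero hl' (mul_ne_zero (pow_ne_zero 2 hγ) (pow_ne_zero 2 hc)))
    linear_combination -e3 + (2 * a * c ^ 3 + c ^ 2) * hlγ
  have k5 : α ^ 4 * (30 * (a * c) ^ 2 + 20 * (a * c) + 1)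
      = 30 * α ^ 2 * γ ^ 2 * (a * c) ^ 2 + 20 * α * γ * (a * c) + 1 := by
    apply mul_left_cancel₀ hl'
    linear_combination -e5 + (30 * a ^ 2 * c ^ 2 + 20 * a * c + 1) * hlα
  have hp : a * c ≠ 0 := mul_ne_zero ha hc
  generalize hpe : a * c = p at *
  have hsq : α ^ 2 = γ ^ 2 := by
    by_contra hne
    have h2p : 2 * p + 1 = 0 := by
      apply mul_left_cancel₀ (sub_ne_zero.2 hne)
      linear_combination k7 - k3
    have hp2 : p = -1 / 2 := by linear_combination h2p / 2
    subst hp2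
    have hαγ : α * γ = 1 := by linear_combination k7
    have h4 : α ^ 4 = 1 := by
      linear_combination (-2 / 3) * k5 - 5 * (α * γ + 1) * hαγ + (20 / 3) * hαγ
    apply hne
    linear_combination γ ^ 2 * h4 - α ^ 2 * (α * γ + 1) * hαγ
  have hfac : (γ - α) * (γ + α) = 0 := by linear_combination -hsq
  rcases mul_eq_zero.1 hfac with h | h
  · have hγα : γ = α := by linear_combination h
    subst hγα
    have : (γ - 1) * (γ + 1) = 0 := by linear_combination k7
    rcases mul_eq_zero.1 this with h | h
    · have h1 : γ = 1 := by linear_combination h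
      subst h1
      exact Or.inl ⟨by ring, by ring⟩
    · have h1 : γ = -1 := by linear_combination h
      subst h1
      exact Or.inr (Or.inl ⟨by linear_combination hlα, by ring, by ring⟩)
  · have hγα : γ = -α := by linear_combination h
    subst hγα
    have q : α ^ 2 * (4 * p + 1) = 1 := by linear_combination k7
    have h4 : (α ^ 2 - 1) * (α ^ 2 + 1) = 0 := by
      linear_combination (-1 / 4) * k5 + (5 / 4) * (α ^ 2 + 1) * q
    rcases mul_eq_zero.1 h4 with h | h
    · exfalso
      apply hp
      linear_combination q / 4 - (4 * p + 1) * h / 4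
    · refine Or.inr (Or.inr ⟨?_, ?_, α, by linear_combination h, rfl, rfl⟩)
      · linear_combination hlα - l' * (α ^ 2 - 1) * h
      · linear_combination -q / 4 + (4 * p + 1) * h / 4

/-- The first `3 × 3` Hankel minor of a sum of two fifth powers of linear forms vanishes. -/
lemma hankel_minor_eq_zero {a c a' c' l l' A₀ A₁ A₂ A₃ A₄ : ℂ}
    (h0 : l * a ^ 5 + l' * a' ^ 5 = A₀)
    (h1 : l * (a ^ 4 * c) + l' * (a' ^ 4 * c') = A₁)
    (h2 : l * (a ^ 3 * c ^ 2) + l' * (a' ^ 3 * c' ^ 2) = A₂)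
    (h3 : l * (a ^ 2 * c ^ 3) + l' * (a' ^ 2 * c' ^ 3) = A₃)
    (h4 : l * (a * c ^ 4) + l' * (a' * c' ^ 4) = A₄) :
    A₀ * (A₂ * A₄ - A₃ ^ 2) - A₁ * (A₁ * A₄ - A₂ * A₃) + A₂ * (A₁ * A₃ - A₂ ^ 2) = 0 := by
  subst h0 h1 h2 h3 h4
  ring

/-- The Hankel minor on rows `0, 1, 3` of a sum of two fifth powers of linear forms vanishes. -/
lemma hankel_minor_eq_zero' {a c a' c' l l' A₀ A₁ A₂ A₃ A₄ A₅ : ℂ}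
    (h0 : l * a ^ 5 + l' * a' ^ 5 = A₀)
    (h1 : l * (a ^ 4 * c) + l' * (a' ^ 4 * c') = A₁)
    (h2 : l * (a ^ 3 * c ^ 2) + l' * (a' ^ 3 * c' ^ 2) = A₂)
    (h3 : l * (a ^ 2 * c ^ 3) + l' * (a' ^ 2 * c' ^ 3) = A₃)
    (h4 : l * (a * c ^ 4) + l' * (a' * c' ^ 4) = A₄)
    (h5 : l * c ^ 5 + l' * c' ^ 5 = A₅) :
    A₀ * (A₂ * A₅ - A₃ * A₄) - A₁ * (A₁ * A₅ - A₃ ^ 2) + A₂ * (A₁ * A₄ - A₂ * A₃) = 0 := by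
  subst h0 h1 h2 h3 h4 h5
  ring

/-- The even part in `x` of `(a x² + xy + c y²)⁵ - (ε a x² + xy - ε c y²)⁵`, where `ε² = -1` and
`a c = -1/2`, is not a sum of two fifth powers of forms in `x², y²`. -/
lemma false_of_special_even_part {a c a' c' l l' m u v ε : ℂ} (hm : m ≠ 0) (huv : u * v = -1 / 2)
    (hε : ε ^ 2 = -1)
    (h0 : l * a ^ 5 + l' * a' ^ 5 = m * (u ^ 5 - (ε * u) ^ 5))
    (h1 : l * (a ^ 4 * c) + l' * (a' ^ 4 * c') = m * ((2 * u ^ 3 + u ^ 4 * v)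
      - (2 * (ε * u) ^ 3 + (ε * u) ^ 4 * (-ε * v))))
    (h2 : l * (a ^ 3 * c ^ 2) + l' * (a' ^ 3 * c' ^ 2) =
      m * ((u / 2 + 3 * u ^ 2 * v + u ^ 3 * v ^ 2)
        - (ε * u / 2 + 3 * (ε * u) ^ 2 * (-ε * v) + (ε * u) ^ 3 * (-ε * v) ^ 2)))
    (h3 : l * (a ^ 2 * c ^ 3) + l' * (a' ^ 2 * c' ^ 3) =
      m * ((v / 2 + 3 * u * v ^ 2 + u ^ 2 * v ^ 3)
        - (-ε * v / 2 + 3 * (ε * u) * (-ε * v) ^ 2 + (ε * u) ^ 2 * (-ε * v) ^ 3)))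
    (h4 : l * (a * c ^ 4) + l' * (a' * c' ^ 4) = m * ((2 * v ^ 3 + u * v ^ 4)
      - (2 * (-ε * v) ^ 3 + (ε * u) * (-ε * v) ^ 4))) : False := by
  have hu : u ≠ 0 := by rintro rfl; norm_num at huv
  have hv : v = -1 / (2 * u) := by field_simp; linear_combination 2 * huv
  have e3 : ε ^ 3 = -ε := by linear_combination ε * hε
  have e4 : ε ^ 4 = 1 := by linear_combination (ε ^ 2 - 1) * hε
  have e5 : ε ^ 5 = ε := by linear_combination ε * (ε ^ 2 - 1) * hε
  have g0 : m * (u ^ 5 - (ε * u) ^ 5) = m * ((1 - ε) * u ^ 5) := by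
    rw [mul_pow, e5]; ring
  have g1 : m * ((2 * u ^ 3 + u ^ 4 * v) - (2 * (ε * u) ^ 3 + (ε * u) ^ 4 * (-ε * v)))
      = m * ((1 + ε) * (3 / 2 * u ^ 3)) := by
    rw [mul_pow, mul_pow, e3, e4]; linear_combination m * (1 + ε) * u ^ 3 * huv
  have g2 : m * ((u / 2 + 3 * u ^ 2 * v + u ^ 3 * v ^ 2)
        - (ε * u / 2 + 3 * (ε * u) ^ 2 * (-ε * v) + (ε * u) ^ 3 * (-ε * v) ^ 2))
      = m * ((1 - ε) * (-3 / 4 * u)) := by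
    simp only [mul_pow, neg_sq, e3, hε]
    linear_combination m * (1 - ε) * u * (u * v + 5 / 2) * huv
  have g3 : m * ((v / 2 + 3 * u * v ^ 2 + u ^ 2 * v ^ 3)
        - (-ε * v / 2 + 3 * (ε * u) * (-ε * v) ^ 2 + (ε * u) ^ 2 * (-ε * v) ^ 3))
      = m * ((1 + ε) * (-3 / 4 * v)) := by
    have : (-ε) ^ 3 = ε := by linear_combination -e3
    simp only [mul_pow, neg_sq, this, hε]
    linear_combination m * (1 + ε) * v * (u * v + 5 / 2) * huv
  have g4 : m * ((2 * v ^ 3 + u * v ^ 4) - (2 * (-ε * v) ^ 3 + (ε * u) * (-ε * v) ^ 4))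
      = m * ((1 - ε) * (3 / 2 * v ^ 3)) := by
    have h3 : (-ε) ^ 3 = ε := by linear_combination -e3
    have h4 : (-ε) ^ 4 = 1 := by linear_combination e4
    simp only [mul_pow, h3, h4]
    linear_combination m * (1 - ε) * v ^ 3 * huv
  rw [g0] at h0
  rw [g1] at h1
  rw [g2] at h2
  rw [g3] at h3
  rw [g4] at h4
  have key := hankel_minor_eq_zero h0 h1 h2 h3 h4
  have hε1 : 1 - ε ≠ 0 := by
    intro h
    have : ε = 1 := by linear_combination -h
    rw [this] at hε; norm_num at hε
  have hε0 : ε ≠ 0 := by rintro rfl; norm_num at hε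
  have : m ^ 3 * (ε * (1 - ε) * u ^ 3) = 0 := by
    rw [hv] at key
    field_simp at key
    linear_combination (-1 / 9216) * key
  simp [hm, hε1, hε0, hu] at this

/-- If `(a x² + xy + c y²)⁵ + (a x² - xy + c y²)⁵` is a sum of two fifth powers of forms in
`x², y²`, then `a c = -1/8`. -/
lemma mul_eq_of_even_part {a c a' c' l l' m u v : ℂ} (hl : l ≠ 0) (hm : m ≠ 0)
    (hD : a * c' - c * a' ≠ 0)
    (h0 : l * a ^ 5 + l' * a' ^ 5 = m * u ^ 5)
    (h1 : l * (a ^ 4 * c) + l' * (a' ^ 4 * c') = m * (2 * u ^ 3 + u ^ 4 * v))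
    (h2 : l * (a ^ 3 * c ^ 2) + l' * (a' ^ 3 * c' ^ 2) =
      m * (u / 2 + 3 * u ^ 2 * v + u ^ 3 * v ^ 2))
    (h3 : l * (a ^ 2 * c ^ 3) + l' * (a' ^ 2 * c' ^ 3) =
      m * (v / 2 + 3 * u * v ^ 2 + u ^ 2 * v ^ 3))
    (h4 : l * (a * c ^ 4) + l' * (a' * c' ^ 4) = m * (2 * v ^ 3 + u * v ^ 4))
    (h5 : l * c ^ 5 + l' * c' ^ 5 = m * v ^ 5) : u * v = -1 / 8 := by
  have k0 := hankel_minor_eq_zero h0 h1 h2 h3 h4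
  have k1 := hankel_minor_eq_zero (a := c) (c := a) (a' := c') (c' := a') (l := l) (l' := l')
    (by rw [h5]) (A₁ := m * (2 * v ^ 3 + u * v ^ 4)) (by linear_combination h4)
    (A₂ := m * (v / 2 + 3 * u * v ^ 2 + u ^ 2 * v ^ 3)) (by linear_combination h3)
    (A₃ := m * (u / 2 + 3 * u ^ 2 * v + u ^ 3 * v ^ 2)) (by linear_combination h2)
    (A₄ := m * (2 * u ^ 3 + u ^ 4 * v)) (by linear_combination h1)
  have k2 := hankel_minor_eq_zero' h0 h1 h2 h3 h4 h5
  have r0 : m ^ 3 * (u ^ 3 * ((2 * (u * v) + 1) * (8 * (u * v) + 1))) = 0 := by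
    linear_combination (-8) * k0
  have r1 : m ^ 3 * (v ^ 3 * ((2 * (u * v) + 1) * (8 * (u * v) + 1))) = 0 := by
    linear_combination (-8) * k1
  by_contra hne
  have hne' : 8 * (u * v) + 1 ≠ 0 := fun h => hne (by linear_combination h / 8)
  have hz : ¬ (u = 0 ∧ v = 0) := by
    rintro ⟨rfl, rfl⟩
    have ha : l * a ^ 4 * (a * c' - c * a') = 0 := by
      linear_combination c' * h0 - a' * h1
    have hc : l * c ^ 4 * (a * c' - c * a') = 0 := by
      linear_combination c' * h4 - a' * h5
    have ha : a = 0 := by simpa [hl, hD] using ha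
    have hc : c = 0 := by simpa [hl, hD] using hc
    exact hD (by rw [ha, hc]; ring)
  have h2p : 2 * (u * v) + 1 = 0 := by
    by_contra h2p
    apply hz
    constructor
    · simpa [hm, h2p, hne'] using r0
    · simpa [hm, h2p, hne'] using r1
  have hu : u ≠ 0 := by rintro rfl; norm_num at h2p
  have hv : v = -1 / (2 * u) := by field_simp; linear_combination h2p
  rw [hv] at k2
  field_simp at k2
  ring_nf at k2
  simp [hm, hu] at k2

/-- When `u v = -1/8`, the linear forms whose fifth powers represent the even part are the zeros of
the apolar quadratic. -/
lemma apolar_of_even_part {a c a' c' l l' m u v : ℂ} (hl : l ≠ 0)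
    (hD : a * c' - c * a' ≠ 0) (huv : u * v = -1 / 8)
    (h0 : l * a ^ 5 + l' * a' ^ 5 = m * u ^ 5)
    (h1 : l * (a ^ 4 * c) + l' * (a' ^ 4 * c') = m * (2 * u ^ 3 + u ^ 4 * v))
    (h2 : l * (a ^ 3 * c ^ 2) + l' * (a' ^ 3 * c' ^ 2) =
      m * (u / 2 + 3 * u ^ 2 * v + u ^ 3 * v ^ 2))
    (h3 : l * (a ^ 2 * c ^ 3) + l' * (a' ^ 2 * c' ^ 3) =
      m * (v / 2 + 3 * u * v ^ 2 + u ^ 2 * v ^ 3))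
    (h4 : l * (a * c ^ 4) + l' * (a' * c' ^ 4) = m * (2 * v ^ 3 + u * v ^ 4))
    (h5 : l * c ^ 5 + l' * c' ^ 5 = m * v ^ 5) :
    3 * (a * v) ^ 2 + 2 * (a * v) * (c * u) + 3 * (c * u) ^ 2 = 0 := by
  set z := 3 * (a * v) ^ 2 + 2 * (a * v) * (c * u) + 3 * (c * u) ^ 2 with hz
  set z' := 3 * (a' * v) ^ 2 + 2 * (a' * v) * (c' * u) + 3 * (c' * u) ^ 2 with hz'
  have w0 : l * a ^ 3 * z + l' * a' ^ 3 * z' = 0 := by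
    linear_combination 3 * v ^ 2 * h0 + 2 * u * v * h1 + 3 * u ^ 2 * h2
      + 8 * m * u ^ 3 * (u * v + 3 / 2) * huv
  have w1 : l * a ^ 2 * c * z + l' * a' ^ 2 * c' * z' = 0 := by
    linear_combination 3 * v ^ 2 * h1 + 2 * u * v * h2 + 3 * u ^ 2 * h3
      + 8 * m * u ^ 2 * v * (u * v + 5 / 2) * huv
  have w2 : l * a * c ^ 2 * z + l' * a' * c' ^ 2 * z' = 0 := by
    linear_combination 3 * v ^ 2 * h2 + 2 * u * v * h3 + 3 * u ^ 2 * h4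
      + 8 * m * v ^ 2 * u * (u * v + 5 / 2) * huv
  have w3 : l * c ^ 3 * z + l' * c' ^ 3 * z' = 0 := by
    linear_combination 3 * v ^ 2 * h3 + 2 * u * v * h4 + 3 * u ^ 2 * h5
      + 8 * m * v ^ 3 * (u * v + 3 / 2) * huv
  by_contra hne
  have ha : l * a ^ 2 * z * (a * c' - c * a') = 0 := by
    linear_combination c' * w0 - a' * w1
  have hc : l * c ^ 2 * z * (a * c' - c * a') = 0 := by
    linear_combination c' * w2 - a' * w3
  have ha : a = 0 := by simpa [hl, hD, hne] using ha
  have hc : c = 0 := by simpa [hl, hD, hne] using hc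
  exact hD (by rw [ha, hc]; ring)

/-- The coefficients of `(a x² + b x + c)⁵`, in increasing degree. -/
def quadPowFiveCoeff (a b c : ℂ) : Fin 11 → ℂ :=
  ![c ^ 5,
    5 * b * c ^ 4,
    10 * b ^ 2 * c ^ 3 + 5 * a * c ^ 4,
    10 * b ^ 3 * c ^ 2 + 20 * a * b * c ^ 3,
    5 * b ^ 4 * c + 30 * a * b ^ 2 * c ^ 2 + 10 * a ^ 2 * c ^ 3,
    b ^ 5 + 20 * a * b ^ 3 * c + 30 * a ^ 2 * b * c ^ 2,
    5 * a * b ^ 4 + 30 * a ^ 2 * b ^ 2 * c + 10 * a ^ 3 * c ^ 2,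
    10 * a ^ 2 * b ^ 3 + 20 * a ^ 3 * b * c,
    10 * a ^ 3 * b ^ 2 + 5 * a ^ 4 * c,
    5 * a ^ 4 * b,
    a ^ 5]

lemma quad_pow_five (a b c x : ℂ) :
    (a * x ^ 2 + b * x + c) ^ 5 = ∑ k : Fin 11, quadPowFiveCoeff a b c k * x ^ (k : ℕ) := by
  simp [Fin.sum_univ_succ, quadPowFiveCoeff]
  ring

lemma eq_zero_of_forall_sum_pow_eq_zero {n : ℕ} (e : Fin n → ℂ)
    (h : ∀ x : ℂ, ∑ k, e k * x ^ (k : ℕ) = 0) (k : Fin n) : e k = 0 := by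
  have hp : ∑ k : Fin n, Polynomial.C (e k) * Polynomial.X ^ (k : ℕ) = 0 := by
    apply Polynomial.funext
    intro x
    simpa [Polynomial.eval_finsetSum] using h x
  have := congrArg (fun p => Polynomial.coeff p (k : ℕ)) hp
  simpa [Polynomial.finsetSum_coeff, Polynomial.coeff_C_mul, Polynomial.coeff_X_pow,
    Fin.val_inj] using this

/-- Binary quadratic forms, viewed as functions, pairwise non-proportional, whose fifth powers
satisfy a linear relation with nonzero coefficients. -/
structure IsFifthPowerRelation (F : Fin 4 → ℂ → ℂ → ℂ) (l : Fin 4 → ℂ) : Prop where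
  quad : ∀ j, ∃ a b c : ℂ, ∀ x y, F j x y = a * x ^ 2 + b * x * y + c * y ^ 2
  indep : ∀ i j, i ≠ j → ∀ k k' : ℂ, (∀ x y, k * F i x y + k' * F j x y = 0) → k = 0 ∧ k' = 0
  ne_zero : ∀ j, l j ≠ 0
  rel : ∀ x y, ∑ j, l j * F j x y ^ 5 = 0

/-- The Desboves–Elkies forms as functions. -/
noncomputable def desbovesElkies (k : Fin 4) (x y : ℂ) : ℂ :=
  Complex.I ^ (k : ℕ) * x ^ 2 + Complex.I * (Real.sqrt 2 : ℂ) * x * y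
    + Complex.I⁻¹ ^ (k : ℕ) * y ^ 2

/-- The forms `F` are, up to a linear change of variables, a permutation and scaling, the
Desboves–Elkies forms. -/
def IsDesbovesElkiesCousin (F : Fin 4 → ℂ → ℂ → ℂ) : Prop :=
  ∃ (a b c d : ℂ) (π : Equiv.Perm (Fin 4)) (cs : Fin 4 → ℂ),
    a * d - b * c ≠ 0 ∧ (∀ j, cs j ≠ 0) ∧
    ∀ j x y, F j x y = cs j * desbovesElkies (π j) (a * x + b * y) (c * x + d * y)

lemma forall_of_forall_linear {P : ℂ → ℂ → Prop} {p q r s : ℂ} (h : p * s - q * r ≠ 0)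
    (hP : ∀ x y, P (p * x + q * y) (r * x + s * y)) (x y : ℂ) : P x y := by
  have := hP ((s * x - q * y) / (p * s - q * r)) ((p * y - r * x) / (p * s - q * r))
  rwa [← mul_div_assoc, ← mul_div_assoc, ← mul_div_assoc, ← mul_div_assoc, ← add_div, ← add_div,
    show p * (s * x - q * y) + q * (p * y - r * x) = x * (p * s - q * r) by ring,
    show r * (s * x - q * y) + s * (p * y - r * x) = y * (p * s - q * r) by ring,
    mul_div_cancel_right₀ _ h, mul_div_cancel_right₀ _ h] at this

lemma IsFifthPowerRelation.comp {F : Fin 4 → ℂ → ℂ → ℂ} {l : Fin 4 → ℂ}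
    (hF : IsFifthPowerRelation F l) {p q r s : ℂ} (h : p * s - q * r ≠ 0) :
    IsFifthPowerRelation (fun j x y => F j (p * x + q * y) (r * x + s * y)) l where
  quad j := by
    obtain ⟨a, b, c, hq⟩ := hF.quad j
    refine ⟨a * p ^ 2 + b * p * r + c * r ^ 2, 2 * a * p * q + b * (p * s + q * r) + 2 * c * r * s,
      a * q ^ 2 + b * q * s + c * s ^ 2, fun x y => ?_⟩
    rw [hq]
    ring
  indep i j hij k k' hk :=
    hF.indep i j hij k k' (forall_of_forall_linear
      (P := fun x y => k * F i x y + k' * F j x y = 0) h hk)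
  ne_zero := hF.ne_zero
  rel x y := hF.rel _ _

lemma IsFifthPowerRelation.perm {F : Fin 4 → ℂ → ℂ → ℂ} {l : Fin 4 → ℂ}
    (hF : IsFifthPowerRelation F l) (σ : Equiv.Perm (Fin 4)) :
    IsFifthPowerRelation (F ∘ σ) (l ∘ σ) where
  quad j := hF.quad (σ j)
  indep i j hij := hF.indep _ _ (σ.injective.ne hij)
  ne_zero j := hF.ne_zero (σ j)
  rel x y := by
    rw [← hF.rel x y]
    exact Equiv.sum_comp σ (fun j => l j * F j x y ^ 5)

lemma IsDesbovesElkiesCousin.of_comp {F : Fin 4 → ℂ → ℂ → ℂ} {p q r s : ℂ}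
    (h : p * s - q * r ≠ 0)
    (hF : IsDesbovesElkiesCousin (fun j x y => F j (p * x + q * y) (r * x + s * y))) :
    IsDesbovesElkiesCousin F := by
  obtain ⟨a, b, c, d, π, cs, hd, hcs, hF⟩ := hF
  set D := p * s - q * r with hD
  refine ⟨(a * s - b * r) / D, (b * p - a * q) / D, (c * s - d * r) / D, (d * p - c * q) / D,
    π, cs, ?_, hcs, fun j => forall_of_forall_linear h fun x y => ?_⟩
  · have : (a * s - b * r) / D * ((d * p - c * q) / D) - (b * p - a * q) / D * ((c * s - d * r) / D)
        = (a * d - b * c) / D := by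
      field_simp
      rw [hD]
      ring
    rw [this]
    exact div_ne_zero hd h
  · refine (hF j x y).trans ?_
    congr 2 <;> field_simp <;> rw [hD] <;> ring

lemma IsDesbovesElkiesCousin.of_perm {F : Fin 4 → ℂ → ℂ → ℂ} (σ : Equiv.Perm (Fin 4))
    (hF : IsDesbovesElkiesCousin (F ∘ σ)) : IsDesbovesElkiesCousin F := by
  obtain ⟨a, b, c, d, π, cs, hd, hcs, hF⟩ := hF
  refine ⟨a, b, c, d, σ.symm.trans π, cs ∘ σ.symm, hd, fun j => hcs _, fun j x y => ?_⟩
  have := hF (σ.symm j) x y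
  simpa using this

section Coefficients

variable {F : Fin 4 → ℂ → ℂ → ℂ} {l a b c : Fin 4 → ℂ}

lemma IsFifthPowerRelation.coeff_eq_zero (hF : IsFifthPowerRelation F l)
    (hq : ∀ j x y, F j x y = a j * x ^ 2 + b j * x * y + c j * y ^ 2) (k : Fin 11) :
    ∑ j, l j * quadPowFiveCoeff (a j) (b j) (c j) k = 0 := by
  refine eq_zero_of_forall_sum_pow_eq_zero
    (fun k => ∑ j, l j * quadPowFiveCoeff (a j) (b j) (c j) k) (fun x => ?_) k
  have h := hF.rel x 1
  simp only [hq, mul_one, one_pow, quad_pow_five] at h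
  rw [← h]
  simp only [Finset.sum_mul, Finset.mul_sum]
  rw [Finset.sum_comm]
  simp only [mul_assoc]

lemma IsFifthPowerRelation.not_minors_eq_zero (hF : IsFifthPowerRelation F l)
    (hq : ∀ j x y, F j x y = a j * x ^ 2 + b j * x * y + c j * y ^ 2) {i j : Fin 4} (hij : i ≠ j)
    (h1 : a i * b j - a j * b i = 0) (h2 : a i * c j - a j * c i = 0)
    (h3 : b i * c j - b j * c i = 0) : False := by
  have ha : a j = 0 := by
    refine (hF.indep i j hij (a j) (-a i) fun x y => ?_).1
    rw [hq, hq]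
    linear_combination -x * y * h1 - y ^ 2 * h2
  have hb : b j = 0 := by
    refine (hF.indep i j hij (b j) (-b i) fun x y => ?_).1
    rw [hq, hq]
    linear_combination x ^ 2 * h1 - y ^ 2 * h3
  have hc : c j = 0 := by
    refine (hF.indep i j hij (c j) (-c i) fun x y => ?_).1
    rw [hq, hq]
    linear_combination x ^ 2 * h2 + x * y * h3
  have := (hF.indep i j hij 0 1 fun x y => by rw [hq j, ha, hb, hc]; ring).2
  exact one_ne_zero this

end Coefficients

lemma IsFifthPowerRelation.exists_coeff {F : Fin 4 → ℂ → ℂ → ℂ} {l : Fin 4 → ℂ}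
    (hF : IsFifthPowerRelation F l) : ∃ a b c : Fin 4 → ℂ,
      ∀ j x y, F j x y = a j * x ^ 2 + b j * x * y + c j * y ^ 2 := by
  choose a b c h using hF.quad
  exact ⟨a, b, c, h⟩

lemma I_mul_sqrt_two_sq : (Complex.I * (Real.sqrt 2 : ℂ)) ^ 2 = -2 := by
  rw [mul_pow, Complex.I_sq, ← Complex.ofReal_pow, Real.sq_sqrt (by norm_num)]
  norm_num

/-- The explicit normal form is a cousin of the Desboves–Elkies forms. -/
lemma isDesbovesElkiesCousin_of_normal_form {F : Fin 4 → ℂ → ℂ → ℂ}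
    {a c a₀ c₀ a₁ c₁ b₂ b₃ : ℂ} (hac : a * c = -1 / 8) (hD : a₀ * c₁ - a₁ * c₀ ≠ 0)
    (hb₂ : b₂ ≠ 0) (hb₃ : b₃ ≠ 0)
    (h0 : 3 * (a₀ * c) = -(1 + 2 * (Complex.I * (Real.sqrt 2 : ℂ))) * (c₀ * a))
    (h1 : 3 * (a₁ * c) = -(1 - 2 * (Complex.I * (Real.sqrt 2 : ℂ))) * (c₁ * a))
    (hF0 : ∀ x y, F 0 x y = a₀ * x ^ 2 + c₀ * y ^ 2)
    (hF1 : ∀ x y, F 1 x y = a₁ * x ^ 2 + c₁ * y ^ 2)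
    (hF2 : ∀ x y, F 2 x y = b₂ * (a * x ^ 2 + x * y + c * y ^ 2))
    (hF3 : ∀ x y, F 3 x y = b₃ * (-a * x ^ 2 + x * y - c * y ^ 2)) :
    IsDesbovesElkiesCousin F := by
  obtain ⟨σ, hσ⟩ : ∃ σ : ℂ, σ ^ 2 = a := IsAlgClosed.exists_pow_nat_eq a two_pos
  have hI := Complex.I_sq
  have hw := I_mul_sqrt_two_sq
  have ha : a ≠ 0 := by rintro rfl; norm_num at hac
  have hc : c ≠ 0 := by rintro rfl; norm_num at hac
  have hdE : desbovesElkies = fun (k : Fin 4) (x y : ℂ) => Complex.I ^ (k : ℕ) * x ^ 2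
    + Complex.I * (Real.sqrt 2 : ℂ) * x * y + Complex.I⁻¹ ^ (k : ℕ) * y ^ 2 := rfl
  generalize Complex.I * (Real.sqrt 2 : ℂ) = w at *
  obtain ⟨τ, hτ⟩ : ∃ τ, τ = 2 * Complex.I * w * c * σ := ⟨_, rfl⟩
  have hτ2 : τ ^ 2 = -c := by
    rw [hτ]
    linear_combination 4 * w ^ 2 * c ^ 2 * σ ^ 2 * hI - 4 * c ^ 2 * σ ^ 2 * hw
      + 8 * c ^ 2 * hσ + 8 * c * hac
  have hστ : 4 * Complex.I * (σ * τ) = w := by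
    rw [hτ]
    linear_combination 8 * σ ^ 2 * w * c * hI - 8 * w * c * hσ - 8 * w * hac
  have hw0 : w ≠ 0 := by rintro rfl; norm_num at hw
  have hw1 : 2 + w ≠ 0 := by
    intro h
    have : w = -2 := by linear_combination h
    rw [this] at hw; norm_num at hw
  have hw2 : 2 - w ≠ 0 := by
    intro h
    have : w = 2 := by linear_combination -h
    rw [this] at hw; norm_num at hw
  have hc0 : c₀ ≠ 0 := by
    rintro rfl
    have : a₀ = 0 := by simpa [hc] using h0
    exact hD (by rw [this]; ring)
  have hc1 : c₁ ≠ 0 := by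
    rintro rfl
    have : a₁ = 0 := by simpa [hc] using h1
    exact hD (by rw [this]; ring)
  have hσ0 : σ ≠ 0 := by rintro rfl; simp at hσ; exact ha hσ.symm
  have hτ0 : τ ≠ 0 := by rintro rfl; simp at hτ2; exact hc hτ2
  have hI1 : Complex.I⁻¹ = -Complex.I := Complex.inv_I
  have hI3 : Complex.I ^ 3 = -Complex.I := Complex.I_pow_three
  have hnI3 : (-Complex.I) ^ 3 = Complex.I := by linear_combination -hI3
  refine ⟨σ / 2, τ / 2, σ / 2, -τ / 2, Equiv.swap 1 2,
    ![16 / 3 * a * c₀ * (2 + w), -16 / 3 * a * c₁ * (2 - w), -2 * w * b₂, 2 * w * b₃], ?_, ?_, ?_⟩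
  · have : σ / 2 * (-τ / 2) - τ / 2 * (σ / 2) = -(σ * τ) / 2 := by ring
    rw [this]
    simp [hσ0, hτ0]
  · intro j
    fin_cases j <;> simp [*]
  · have e0 : ∀ x y : ℂ, desbovesElkies 0 (σ / 2 * x + τ / 2 * y) (σ / 2 * x + -τ / 2 * y)
        = (2 + w) / 4 * a * x ^ 2 - (2 - w) / 4 * c * y ^ 2 := by
      intro x y
      simp only [hdE, Fin.val_zero, pow_zero]
      linear_combination (2 + w) / 4 * x ^ 2 * hσ + (2 - w) / 4 * y ^ 2 * hτ2
    have e1 : ∀ x y : ℂ, desbovesElkies 1 (σ / 2 * x + τ / 2 * y) (σ / 2 * x + -τ / 2 * y)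
        = w / 4 * (a * x ^ 2 + x * y + c * y ^ 2) := by
      intro x y
      simp only [hdE, Fin.val_one, pow_one, hI1]
      linear_combination w / 4 * x ^ 2 * hσ - w / 4 * y ^ 2 * hτ2 + x * y / 4 * hστ
    have e2 : ∀ x y : ℂ, desbovesElkies 2 (σ / 2 * x + τ / 2 * y) (σ / 2 * x + -τ / 2 * y)
        = -(2 - w) / 4 * a * x ^ 2 + (2 + w) / 4 * c * y ^ 2 := by
      intro x y
      simp only [hdE, Fin.val_two, hI1, neg_sq, hI]
      linear_combination -(2 - w) / 4 * x ^ 2 * hσ - (2 + w) / 4 * y ^ 2 * hτ2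
    have e3 : ∀ x y : ℂ, desbovesElkies 3 (σ / 2 * x + τ / 2 * y) (σ / 2 * x + -τ / 2 * y)
        = w / 4 * (a * x ^ 2 - x * y + c * y ^ 2) := by
      intro x y
      simp only [hdE, show ((3 : Fin 4) : ℕ) = 3 from rfl, hI1, hI3, hnI3]
      linear_combination w / 4 * x ^ 2 * hσ - w / 4 * y ^ 2 * hτ2 - x * y / 4 * hστ
    have s0 : Equiv.swap (1 : Fin 4) 2 0 = 0 := by decide
    have s1 : Equiv.swap (1 : Fin 4) 2 1 = 2 := by decide
    have s2 : Equiv.swap (1 : Fin 4) 2 2 = 1 := by decide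
    have s3 : Equiv.swap (1 : Fin 4) 2 3 = 3 := by decide
    have ha₀ : a₀ = 8 / 3 * (1 + 2 * w) * c₀ * a ^ 2 := by
      linear_combination (-8 / 3 * a) * h0 + 8 * a₀ * hac
    have ha₁ : a₁ = 8 / 3 * (1 - 2 * w) * c₁ * a ^ 2 := by
      linear_combination (-8 / 3 * a) * h1 + 8 * a₁ * hac
    have w2 : w ^ 2 = -2 := hw
    intro j x y
    fin_cases j
    · simp only [Fin.zero_eta, s0, hF0, e0]
      simp only [Matrix.cons_val_zero]
      rw [ha₀]
      linear_combination -4 / 3 * c₀ * a * (a * x ^ 2 + c * y ^ 2) * w2 + 8 * c₀ * y ^ 2 * hac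
    · simp only [Fin.mk_one, s1, hF1, e2]
      simp only [Matrix.cons_val_one, Matrix.cons_val_zero]
      rw [ha₁]
      linear_combination -4 / 3 * c₁ * a * (a * x ^ 2 + c * y ^ 2) * w2 + 8 * c₁ * y ^ 2 * hac
    · simp only [Fin.reduceFinMk, s2, hF2, e1]
      simp
      linear_combination b₂ / 2 * (a * x ^ 2 + x * y + c * y ^ 2) * w2
    · simp only [Fin.reduceFinMk, s3, hF3, e3]
      simp
      linear_combination -b₃ / 2 * (a * x ^ 2 - x * y + c * y ^ 2) * w2

lemma eq_zero_of_odd_part {a b c l : ℂ} (hl : l ≠ 0) (h1 : l * (5 * b * c ^ 4) = 0)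
    (h5 : l * (b ^ 5 + 20 * a * b ^ 3 * c + 30 * a ^ 2 * b * c ^ 2) = 0)
    (h9 : l * (5 * a ^ 4 * b) = 0) : b = 0 := by
  by_contra hb
  have ha : a = 0 := by simpa [hl, hb] using h9
  have hc : c = 0 := by simpa [hl, hb] using h1
  simp [ha, hc, hl, hb] at h5

/-- The case where the first two forms are diagonal. -/
lemma IsFifthPowerRelation.isCousin_of_diagonal {F : Fin 4 → ℂ → ℂ → ℂ} {l a b c : Fin 4 → ℂ}
    (hF : IsFifthPowerRelation F l)
    (hq : ∀ j x y, F j x y = a j * x ^ 2 + b j * x * y + c j * y ^ 2)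
    (hb0 : b 0 = 0) (hb1 : b 1 = 0) : IsDesbovesElkiesCousin F := by
  have E := hF.coeff_eq_zero hq
  have E0 := E 0
  have E1 := E 1
  have E2 := E 2
  have E3 := E 3
  have E4 := E 4
  have E5 := E 5
  have E6 := E 6
  have E7 := E 7
  have E8 := E 8
  have E9 := E 9
  have E10 := E 10
  clear E
  simp only [Fin.sum_univ_four, quadPowFiveCoeff, hb0, hb1] at E0 E1 E2 E3 E4 E5 E6 E7 E8 E9 E10
  simp at E0 E1 E2 E3 E4 E5 E6 E7 E8 E9 E10
  have hl := hF.ne_zero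
  have hD : a 0 * c 1 - c 0 * a 1 ≠ 0 := fun h =>
    hF.not_minors_eq_zero hq (i := 0) (j := 1) (by decide) (by rw [hb0, hb1]; ring)
      (by linear_combination h) (by rw [hb0, hb1]; ring)
  have hall : ¬ (b 2 = 0 ∧ b 3 = 0) := by
    rintro ⟨hb2, hb3⟩
    have hb : ∀ j, b j = 0 := by
      intro j
      fin_cases j <;> assumption
    simp only [hb2, hb3] at E0 E2 E4 E6 E8 E10
    refine false_of_fifth_powers_of_four_linear_forms a c l (fun i j hij h => ?_) (hl 0)
      ?_ ?_ ?_ ?_ ?_ ?_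
    · exact hF.not_minors_eq_zero hq hij (by rw [hb i, hb j]; ring) (by linear_combination h)
        (by rw [hb i, hb j]; ring)
    all_goals simp only [Fin.sum_univ_four]
    · linear_combination E10
    · linear_combination E8 / 5
    · linear_combination E6 / 10
    · linear_combination E4 / 10
    · linear_combination E2 / 5
    · linear_combination E0
  have hb2 : b 2 ≠ 0 := fun h => hall ⟨h, by
    simp only [h] at E1 E5 E9
    exact eq_zero_of_odd_part (a := a 3) (c := c 3) (hl 3) (by linear_combination E1)
      (by linear_combination E5)
      (by linear_combination E9)⟩
  have hb3 : b 3 ≠ 0 := fun h => hall ⟨by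
    simp only [h] at E1 E5 E9
    exact eq_zero_of_odd_part (a := a 2) (c := c 2) (hl 2) (by linear_combination E1)
      (by linear_combination E5)
      (by linear_combination E9), h⟩
  obtain ⟨u, hu⟩ : ∃ u, a 2 = b 2 * u := ⟨a 2 / b 2, by field_simp⟩
  obtain ⟨v, hv⟩ : ∃ v, c 2 = b 2 * v := ⟨c 2 / b 2, by field_simp⟩
  obtain ⟨u', hu'⟩ : ∃ u, a 3 = b 3 * u := ⟨a 3 / b 3, by field_simp⟩
  obtain ⟨v', hv'⟩ : ∃ v, c 3 = b 3 * v := ⟨c 3 / b 3, by field_simp⟩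
  obtain ⟨m, hm⟩ : ∃ m, m = l 2 * b 2 ^ 5 := ⟨_, rfl⟩
  obtain ⟨m', hm'⟩ : ∃ m, m = l 3 * b 3 ^ 5 := ⟨_, rfl⟩
  have hm0 : m ≠ 0 := hm ▸ mul_ne_zero (hl 2) (pow_ne_zero 5 hb2)
  have hm0' : m' ≠ 0 := hm' ▸ mul_ne_zero (hl 3) (pow_ne_zero 5 hb3)
  rw [hu, hu', hv, hv'] at E2 E3 E4 E5 E6 E7 E8
  rw [hv, hv'] at E0 E1
  rw [hu, hu'] at E9 E10
  have T := odd_part_fifth_power_trichotomy (a := u) (c := v) (a' := u') (c' := v') hm0 hm0'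
    (by rw [hm, hm']; linear_combination E1 / 5) (by rw [hm, hm']; linear_combination E3 / 10)
    (by rw [hm, hm']; linear_combination E5) (by rw [hm, hm']; linear_combination E7 / 10)
    (by rw [hm, hm']; linear_combination E9 / 5)
  have G10 : l 0 * a 0 ^ 5 + l 1 * a 1 ^ 5 = -(m * u ^ 5 + m' * u' ^ 5) := by
    rw [hm, hm']; linear_combination E10
  have G8 : l 0 * (a 0 ^ 4 * c 0) + l 1 * (a 1 ^ 4 * c 1) =
      -(m * (2 * u ^ 3 + u ^ 4 * v) + m' * (2 * u' ^ 3 + u' ^ 4 * v')) := by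
    rw [hm, hm']; linear_combination E8 / 5
  have G6 : l 0 * (a 0 ^ 3 * c 0 ^ 2) + l 1 * (a 1 ^ 3 * c 1 ^ 2) =
      -(m * (u / 2 + 3 * u ^ 2 * v + u ^ 3 * v ^ 2)
        + m' * (u' / 2 + 3 * u' ^ 2 * v' + u' ^ 3 * v' ^ 2)) := by
    rw [hm, hm']; linear_combination E6 / 10
  have G4 : l 0 * (a 0 ^ 2 * c 0 ^ 3) + l 1 * (a 1 ^ 2 * c 1 ^ 3) =
      -(m * (v / 2 + 3 * u * v ^ 2 + u ^ 2 * v ^ 3)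
        + m' * (v' / 2 + 3 * u' * v' ^ 2 + u' ^ 2 * v' ^ 3)) := by
    rw [hm, hm']; linear_combination E4 / 10
  have G2 : l 0 * (a 0 * c 0 ^ 4) + l 1 * (a 1 * c 1 ^ 4) =
      -(m * (2 * v ^ 3 + u * v ^ 4) + m' * (2 * v' ^ 3 + u' * v' ^ 4)) := by
    rw [hm, hm']; linear_combination E2 / 5
  have G0 : l 0 * c 0 ^ 5 + l 1 * c 1 ^ 5 = -(m * v ^ 5 + m' * v' ^ 5) := by
    rw [hm, hm']; linear_combination E0
  clear E0 E1 E2 E3 E4 E5 E6 E7 E8 E9 E10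
  clear hm hm'
  rcases T with ⟨rfl, rfl⟩ | ⟨rfl, rfl, rfl⟩ | ⟨rfl, huv, ε, hε, rfl, rfl⟩
  · exfalso
    refine hF.not_minors_eq_zero hq (i := 2) (j := 3) (by decide) ?_ ?_ ?_
    all_goals simp only [hu, hv, hu', hv']
    all_goals ring
  · have hm2 : -2 * m ≠ 0 := mul_ne_zero (by norm_num) hm0
    replace G10 : l 0 * a 0 ^ 5 + l 1 * a 1 ^ 5 = -2 * m * u ^ 5 := by
      linear_combination G10
    replace G8 : l 0 * (a 0 ^ 4 * c 0) + l 1 * (a 1 ^ 4 * c 1) =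
        -2 * m * (2 * u ^ 3 + u ^ 4 * v) := by linear_combination G8
    replace G6 : l 0 * (a 0 ^ 3 * c 0 ^ 2) + l 1 * (a 1 ^ 3 * c 1 ^ 2) =
        -2 * m * (u / 2 + 3 * u ^ 2 * v + u ^ 3 * v ^ 2) := by linear_combination G6
    replace G4 : l 0 * (a 0 ^ 2 * c 0 ^ 3) + l 1 * (a 1 ^ 2 * c 1 ^ 3) =
        -2 * m * (v / 2 + 3 * u * v ^ 2 + u ^ 2 * v ^ 3) := by linear_combination G4
    replace G2 : l 0 * (a 0 * c 0 ^ 4) + l 1 * (a 1 * c 1 ^ 4) =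
        -2 * m * (2 * v ^ 3 + u * v ^ 4) := by linear_combination G2
    replace G0 : l 0 * c 0 ^ 5 + l 1 * c 1 ^ 5 = -2 * m * v ^ 5 := by linear_combination G0
    have huv := mul_eq_of_even_part (hl 0) hm2 hD G10 G8 G6 G4 G2 G0
    have z0 := apolar_of_even_part (hl 0) hD huv G10 G8 G6 G4 G2 G0
    rw [add_comm] at G10 G8 G6 G4 G2 G0
    have z1 := apolar_of_even_part (hl 1) (fun h => hD (by linear_combination -h)) huv
      G10 G8 G6 G4 G2 G0
    have hw := I_mul_sqrt_two_sq
    have hu0 : u ≠ 0 := by rintro rfl; norm_num at huv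
    have hv0 : v ≠ 0 := by rintro rfl; norm_num at huv
    have hF2 : ∀ x y, F 2 x y = b 2 * (u * x ^ 2 + x * y + v * y ^ 2) := by
      intro x y
      rw [hq, hu, hv]
      ring
    have hF3 : ∀ x y, F 3 x y = b 3 * (-u * x ^ 2 + x * y - v * y ^ 2) := by
      intro x y
      rw [hq, hu', hv']
      ring
    have hF0 : ∀ x y, F 0 x y = a 0 * x ^ 2 + c 0 * y ^ 2 := by
      intro x y
      rw [hq, hb0]
      ring
    have hF1 : ∀ x y, F 1 x y = a 1 * x ^ 2 + c 1 * y ^ 2 := by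
      intro x y
      rw [hq, hb1]
      ring
    have factor : ∀ R S : ℂ, 3 * R ^ 2 + 2 * R * S + 3 * S ^ 2 = 0 →
        3 * R = -(1 + 2 * (Complex.I * (Real.sqrt 2 : ℂ))) * S ∨
        3 * R = -(1 - 2 * (Complex.I * (Real.sqrt 2 : ℂ))) * S := by
      intro R S h
      have : (3 * R + (1 + 2 * (Complex.I * (Real.sqrt 2 : ℂ))) * S) *
          (3 * R + (1 - 2 * (Complex.I * (Real.sqrt 2 : ℂ))) * S) = 0 := by
        linear_combination 3 * h - 4 * S ^ 2 * hw
      rcases mul_eq_zero.1 this with h | h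
      · exact Or.inl (by linear_combination h)
      · exact Or.inr (by linear_combination h)
    have distinct : ∀ k : ℂ, 3 * (a 0 * v) = k * (c 0 * u) → 3 * (a 1 * v) = k * (c 1 * u) →
        False := by
      intro k h h'
      apply hD
      apply mul_left_cancel₀ (mul_ne_zero hu0 hv0)
      linear_combination c 1 * u / 3 * h - c 0 * u / 3 * h'
    rcases factor _ _ z0 with r0 | r0 <;> rcases factor _ _ z1 with r1 | r1
    · exact (distinct _ r0 r1).elim
    · exact isDesbovesElkiesCousin_of_normal_form huv (fun h => hD (by linear_combination h))
        hb2 hb3 r0 r1 hF0 hF1 hF2 hF3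
    · exact .of_perm (Equiv.swap 0 1) <| isDesbovesElkiesCousin_of_normal_form huv
        (fun h => hD (by linear_combination -h)) hb2 hb3 r1 r0 (by simpa using hF1)
        (by simpa using hF0) hF2 hF3
    · exact (distinct _ r0 r1).elim
  · exact (false_of_special_even_part (l := l 0) (l' := l 1) (a := a 0) (c := c 0)
      (a' := a 1) (c' := c 1) (m := -m) (neg_ne_zero.2 hm0) huv hε
      (by linear_combination G10) (by linear_combination G8) (by linear_combination G6)
      (by linear_combination G4) (by linear_combination G2)).elim

/-- Two coprime binary quadratic forms can be diagonalised simultaneously. -/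
lemma exists_simultaneous_diagonalization {a b c a' b' c' : ℂ}
    (h : (a * c' - a' * c) ^ 2 ≠ (a * b' - a' * b) * (b * c' - b' * c)) :
    ∃ p q r s : ℂ, p * s - q * r ≠ 0 ∧ 2 * a * p * q + b * (p * s + q * r) + 2 * c * r * s = 0 ∧
      2 * a' * p * q + b' * (p * s + q * r) + 2 * c' * r * s = 0 := by
  by_cases hA : a * b' - a' * b = 0
  · have hB : a * c' - a' * c ≠ 0 := by
      intro hB
      rw [hA, hB] at h
      simp at h
    refine ⟨1, b * c' - b' * c, 0, -2 * (a * c' - a' * c), ?_, ?_, ?_⟩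
    · simpa using hB
    · linear_combination -2 * c * hA
    · linear_combination -2 * c' * hA
  · obtain ⟨δ, hδ⟩ := IsAlgClosed.exists_pow_nat_eq
      ((a * c' - a' * c) ^ 2 - (a * b' - a' * b) * (b * c' - b' * c)) two_pos
    have hδ0 : δ ≠ 0 := by
      rintro rfl
      apply h
      linear_combination -hδ
    refine ⟨-(a * c' - a' * c) + δ, -(a * c' - a' * c) - δ, a * b' - a' * b, a * b' - a' * b,
      ?_, ?_, ?_⟩
    · have : (-(a * c' - a' * c) + δ) * (a * b' - a' * b)
          - (-(a * c' - a' * c) - δ) * (a * b' - a' * b) = 2 * δ * (a * b' - a' * b) := by ring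
      rw [this]
      exact mul_ne_zero (mul_ne_zero two_ne_zero hδ0) hA
    · linear_combination -2 * a * hδ
    · linear_combination -2 * a' * hδ

/-- Two non-proportional binary quadratic forms with vanishing resultant have a common zero. -/
lemma exists_common_zero {a b c a' b' c' : ℂ}
    (hne : ¬ (a * b' - a' * b = 0 ∧ a * c' - a' * c = 0 ∧ b * c' - b' * c = 0))
    (h : (a * c' - a' * c) ^ 2 = (a * b' - a' * b) * (b * c' - b' * c)) :
    ∃ p q : ℂ, ¬ (p = 0 ∧ q = 0) ∧ a * p ^ 2 + b * p * q + c * q ^ 2 = 0 ∧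
      a' * p ^ 2 + b' * p * q + c' * q ^ 2 = 0 := by
  by_cases hA : a * b' - a' * b = 0
  · have hB : a * c' - a' * c = 0 := by simpa [hA] using h
    have hC : b * c' - b' * c ≠ 0 := fun hC => hne ⟨hA, hB, hC⟩
    refine ⟨1, 0, by simp, ?_, ?_⟩
    · apply mul_left_cancel₀ hC
      linear_combination b * hB - c * hA
    · apply mul_left_cancel₀ hC
      linear_combination b' * hB - c' * hA
  · refine ⟨-(a * c' - a' * c), a * b' - a' * b, by simp [hA], ?_, ?_⟩
    · linear_combination a * h
    · linear_combination a' * h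

lemma exists_det_ne_zero {p q : ℂ} (h : ¬ (p = 0 ∧ q = 0)) : ∃ r s : ℂ, p * s - r * q ≠ 0 := by
  by_cases hp : p = 0
  · exact ⟨1, 0, by simpa [hp] using h⟩
  · exact ⟨0, 1, by simpa using hp⟩

/-- The four forms have no common zero. -/
lemma IsFifthPowerRelation.false_of_common_zero {F : Fin 4 → ℂ → ℂ → ℂ} {l : Fin 4 → ℂ}
    (hF : IsFifthPowerRelation F l) {p q : ℂ} (hpq : ¬ (p = 0 ∧ q = 0))
    (h : ∀ j, F j p q = 0) : False := by
  obtain ⟨r, s, hd⟩ := exists_det_ne_zero hpq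
  have hG := hF.comp hd
  obtain ⟨a, b, c, hq⟩ := hG.exists_coeff
  have ha : ∀ j, a j = 0 := by
    intro j
    have := hq j 1 0
    simpa [h j] using this.symm
  have E := hG.coeff_eq_zero hq
  have E0 := E 0
  have E1 := E 1
  have E2 := E 2
  have E3 := E 3
  have E4 := E 4
  have E5 := E 5
  simp [quadPowFiveCoeff, ha, Fin.sum_univ_four] at E0 E1 E2 E3 E4 E5
  refine false_of_fifth_powers_of_four_linear_forms b c l (fun i j hij h => ?_) (hF.ne_zero 0)
    ?_ ?_ ?_ ?_ ?_ ?_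
  · exact hG.not_minors_eq_zero hq hij (by rw [ha i, ha j]; ring) (by rw [ha i, ha j]; ring)
      (by linear_combination h)
  all_goals simp only [Fin.sum_univ_four]
  · linear_combination E5
  · linear_combination E4 / 5
  · linear_combination E3 / 10
  · linear_combination E2 / 10
  · linear_combination E1 / 5
  · linear_combination E0

/-- The first two forms and the last two forms cannot both have a common zero. -/
lemma IsFifthPowerRelation.false_of_zeros {F : Fin 4 → ℂ → ℂ → ℂ} {l : Fin 4 → ℂ}
    (hF : IsFifthPowerRelation F l) {p q r s : ℂ} (hpq : ¬ (p = 0 ∧ q = 0))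
    (hrs : ¬ (r = 0 ∧ s = 0)) (h0 : F 0 p q = 0) (h1 : F 1 p q = 0) (h2 : F 2 r s = 0)
    (h3 : F 3 r s = 0) : False := by
  by_cases hd : p * s - r * q = 0
  · obtain ⟨k, hk, rfl, rfl⟩ : ∃ k : ℂ, k ≠ 0 ∧ r = k * p ∧ s = k * q := by
      by_cases hp : p = 0
      · have hq : q ≠ 0 := fun hq => hpq ⟨hp, hq⟩
        have hr : r = 0 := by simpa [hp, hq] using hd
        exact ⟨s / q, div_ne_zero (fun hs => hrs ⟨hr, hs⟩) hq, by simp [hp, hr], by field_simp⟩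
      · have hs : s = r / p * q := by field_simp; linear_combination hd
        refine ⟨r / p, div_ne_zero (fun hr => hrs ⟨hr, ?_⟩) hp, by field_simp, hs⟩
        rw [hs, hr]
        simp
    have scale : ∀ j, F j (k * p) (k * q) = 0 → F j p q = 0 := by
      intro j hj
      obtain ⟨a, b, c, hq⟩ := hF.quad j
      apply mul_left_cancel₀ (pow_ne_zero 2 hk)
      rw [hq] at hj ⊢
      linear_combination hj
    refine hF.false_of_common_zero hpq fun j => ?_
    fin_cases j
    · exact h0
    · exact h1
    · exact scale _ h2
    · exact scale _ h3
  · have hG := hF.comp hd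
    obtain ⟨a, b, c, hq⟩ := hG.exists_coeff
    have ha0 : a 0 = 0 := by simpa [h0] using (hq 0 1 0).symm
    have ha1 : a 1 = 0 := by simpa [h1] using (hq 1 1 0).symm
    have hc2 : c 2 = 0 := by simpa [h2] using (hq 2 0 1).symm
    have hc3 : c 3 = 0 := by simpa [h3] using (hq 3 0 1).symm
    have hD : b 0 * c 1 - b 1 * c 0 ≠ 0 := fun h =>
      hG.not_minors_eq_zero hq (i := 0) (j := 1) (by decide) (by rw [ha0, ha1]; ring)
        (by rw [ha0, ha1]; ring) h
    have E0 := hG.coeff_eq_zero hq 0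
    have E1 := hG.coeff_eq_zero hq 1
    simp [quadPowFiveCoeff, hc2, hc3, Fin.sum_univ_four] at E0 E1
    have hc0 : l 0 * c 0 ^ 4 * (b 0 * c 1 - b 1 * c 0) = 0 := by
      linear_combination c 1 * E1 / 5 - b 1 * E0
    have hc1 : l 1 * c 1 ^ 4 * (b 0 * c 1 - b 1 * c 0) = 0 := by
      linear_combination b 0 * E0 - c 0 * E1 / 5
    have hc0 : c 0 = 0 := by simpa [hF.ne_zero 0, hD] using hc0
    have hc1 : c 1 = 0 := by simpa [hF.ne_zero 1, hD] using hc1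
    exact hD (by rw [hc0, hc1]; ring)

/-- The case where the first two forms are coprime. -/
lemma IsFifthPowerRelation.isCousin_of_coprime {F : Fin 4 → ℂ → ℂ → ℂ} {l a b c : Fin 4 → ℂ}
    (hF : IsFifthPowerRelation F l)
    (hq : ∀ j x y, F j x y = a j * x ^ 2 + b j * x * y + c j * y ^ 2)
    (h : (a 0 * c 1 - a 1 * c 0) ^ 2 ≠ (a 0 * b 1 - a 1 * b 0) * (b 0 * c 1 - b 1 * c 0)) :
    IsDesbovesElkiesCousin F := by
  obtain ⟨p, q, r, s, hd, h0, h1⟩ := exists_simultaneous_diagonalization h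
  refine .of_comp hd ((hF.comp hd).isCousin_of_diagonal
    (a := fun j => a j * p ^ 2 + b j * p * r + c j * r ^ 2)
    (b := fun j => 2 * a j * p * q + b j * (p * s + q * r) + 2 * c j * r * s)
    (c := fun j => a j * q ^ 2 + b j * q * s + c j * s ^ 2) (fun j x y => ?_) h0 h1)
  rw [hq]
  ring

lemma IsFifthPowerRelation.isCousin {F : Fin 4 → ℂ → ℂ → ℂ} {l : Fin 4 → ℂ}
    (hF : IsFifthPowerRelation F l) : IsDesbovesElkiesCousin F := by
  obtain ⟨a, b, c, hq⟩ := hF.exists_coeff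
  by_cases h01 : (a 0 * c 1 - a 1 * c 0) ^ 2 =
      (a 0 * b 1 - a 1 * b 0) * (b 0 * c 1 - b 1 * c 0)
  · by_cases h23 : (a 2 * c 3 - a 3 * c 2) ^ 2 =
        (a 2 * b 3 - a 3 * b 2) * (b 2 * c 3 - b 3 * c 2)
    · obtain ⟨p, q, hpq, h0, h1⟩ := exists_common_zero
        (fun h => hF.not_minors_eq_zero hq (by decide) h.1 h.2.1 h.2.2) h01
      obtain ⟨r, s, hrs, h2, h3⟩ := exists_common_zero
        (fun h => hF.not_minors_eq_zero hq (by decide) h.1 h.2.1 h.2.2) h23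
      rw [← hq] at h0 h1 h2 h3
      exact (hF.false_of_zeros hpq hrs h0 h1 h2 h3).elim
    · let σ : Equiv.Perm (Fin 4) := Equiv.addRight 2
      exact .of_perm σ ((hF.perm σ).isCousin_of_coprime (a := a ∘ σ) (b := b ∘ σ) (c := c ∘ σ)
        (fun j => hq (σ j)) h23)
  · exact hF.isCousin_of_coprime hq h01

lemma exists_eval_eq_of_isHomogeneous_two {f : MvPolynomial (Fin 2) ℂ} (hf : f.IsHomogeneous 2) :
    ∃ a b c : ℂ, ∀ x y, eval ![x, y] f = a * x ^ 2 + b * x * y + c * y ^ 2 := by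
  refine ⟨f.coeff (Finsupp.single 0 2), f.coeff (Finsupp.single 0 1 + Finsupp.single 1 1),
    f.coeff (Finsupp.single 1 2), fun x y => ?_⟩
  have hne1 : (Finsupp.single 0 2 : Fin 2 →₀ ℕ) ≠ Finsupp.single 0 1 + Finsupp.single 1 1 := by
    intro h
    simpa using DFunLike.congr_fun h 1
  have hne2 : (Finsupp.single 0 2 : Fin 2 →₀ ℕ) ≠ Finsupp.single 1 2 := by
    intro h
    simpa using DFunLike.congr_fun h 1
  have hne3 : (Finsupp.single 0 1 + Finsupp.single 1 1 : Fin 2 →₀ ℕ) ≠ Finsupp.single 1 2 := by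
    intro h
    simpa using DFunLike.congr_fun h 0
  rw [eval_eq', Finset.sum_subset (s₂ := {Finsupp.single 0 2,
    Finsupp.single 0 1 + Finsupp.single 1 1, Finsupp.single 1 2})]
  · rw [Finset.sum_insert (by simp [hne1, hne2]), Finset.sum_insert (by simp [hne3]),
      Finset.sum_singleton]
    simp [Fin.prod_univ_two]
    ring
  · intro d hd
    have hdeg := hf (mem_support_iff.1 hd)
    rw [Finsupp.weight_apply, Finsupp.sum_fintype _ _ (by simp), Fin.sum_univ_two] at hdeg
    simp only [Pi.one_apply, smul_eq_mul, mul_one] at hdeg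
    have hext : ∀ e : Fin 2 →₀ ℕ, d 0 = e 0 → d 1 = e 1 → d = e := by
      intro e h0 h1
      ext i
      fin_cases i
      · exact h0
      · exact h1
    have h3 : d 0 = 2 ∨ d 0 = 1 ∨ d 0 = 0 := by omega
    simp only [Finset.mem_insert, Finset.mem_singleton]
    rcases h3 with h | h | h
    · exact Or.inl (hext _ (by simp [h]) (by simp; omega))
    · exact Or.inr (Or.inl (hext _ (by simp [h]) (by simp; omega)))
    · exact Or.inr (Or.inr (hext _ (by simp [h]) (by simp; omega)))
  · intro d _ hd
    rw [notMem_support_iff.1 hd, zero_mul]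

lemma funext_eval_pair {f g : MvPolynomial (Fin 2) ℂ}
    (h : ∀ x y : ℂ, eval ![x, y] f = eval ![x, y] g) : f = g := by
  apply MvPolynomial.funext
  intro v
  have hv : v = ![v 0, v 1] := by
    ext i
    fin_cases i <;> rfl
  rw [hv]
  exact h _ _

lemma eval_quinticForm (k : Fin 4) (x y : ℂ) :
    eval ![x, y] (quinticForm k) = desbovesElkies k x y := by
  simp [quinticForm, desbovesElkies, Px, Py]

lemma eval_linChange_quinticForm (a b c d : ℂ) (k : Fin 4) (x y : ℂ) :
    eval ![x, y] (linChange a b c d (quinticForm k)) =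
      desbovesElkies k (a * x + b * y) (c * x + d * y) := by
  simp [linChange, quinticForm, desbovesElkies, Px, Py]

lemma sum_desbovesElkies_pow_five (x y : ℂ) :
    ∑ k : Fin 4, (-1 : ℂ) ^ (k : ℕ) * desbovesElkies k x y ^ 5 = 0 := by
  have hI := Complex.I_sq
  have hw := I_mul_sqrt_two_sq
  have hI1 : Complex.I⁻¹ = -Complex.I := Complex.inv_I
  have hI3 : Complex.I ^ 3 = -Complex.I := Complex.I_pow_three
  have hnI3 : (-Complex.I) ^ 3 = Complex.I := by linear_combination -hI3
  simp only [Fin.sum_univ_four, desbovesElkies]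
  generalize Complex.I * (Real.sqrt 2 : ℂ) = w at *
  simp only [Fin.val_zero, Fin.val_one, Fin.val_two, show ((3 : Fin 4) : ℕ) = 3 from rfl, hI1,
    neg_sq, hI, hI3, hnI3]
  linear_combination 20 * w * (x * y) ^ 3 * ((x ^ 2 + y ^ 2) ^ 2 + (x ^ 2 - y ^ 2) ^ 2) * hw
    - (20 * w ^ 3 * (x * y) ^ 3 * (x ^ 2 - y ^ 2) ^ 2
      + 10 * w * (x * y) * (x ^ 2 - y ^ 2) ^ 4 * (Complex.I ^ 2 - 1)) * hI


/-- Every `𝒲_2(4,5)` set is a cousin of the Desboves–Elkies set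
`{q_0, q_1, q_2, q_3}` where `q_k = i^k x² + √(−2) xy + i^{−k} y²` (these satisfy
`Σ_{k=0}^{3} (−1)^k q_k^5 = 0`). -/
theorem W2_four_five_is_cousin_of_desboves_elkies
    (f : Fin 4 → MvPolynomial (Fin 2) ℂ) (lam : Fin 4 → ℂ)
    (hhom : ∀ i, (f i).IsHomogeneous 2)
    (hne : ∀ i, f i ≠ 0)
    (hprop : ∀ i j, i ≠ j → ∀ c : ℂ, f i ≠ c • f j)
    (hlam : ∀ i, lam i ≠ 0)
    (hdep : ∑ i, lam i • f i ^ 5 = 0) :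
    (∑ k : Fin 4, ((-1 : ℂ) ^ (k : ℕ)) • quinticForm k ^ 5 = 0) ∧
    ∃ (a b c d : ℂ) (π : Equiv.Perm (Fin 4)) (cs : Fin 4 → ℂ),
      a * d - b * c ≠ 0 ∧ (∀ j, cs j ≠ 0) ∧
      ∀ j, f j = C (cs j) * linChange a b c d (quinticForm (π j)) := by
  refine ⟨funext_eval_pair fun x y => ?_, ?_⟩
  · simpa [smul_eval, eval_quinticForm] using sum_desbovesElkies_pow_five x y
  have hF : IsFifthPowerRelation (fun j x y => eval ![x, y] (f j)) lam := by
    refine ⟨fun j => exists_eval_eq_of_isHomogeneous_two (hhom j), fun i j hij k k' h => ?_, hlam,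
      fun x y => ?_⟩
    · have hk : k • f i + k' • f j = 0 := funext_eval_pair fun x y => by
        simpa [smul_eval] using h x y
      have hk0 : k = 0 := by
        by_contra hk0
        apply hprop i j hij (-(k' / k))
        rw [neg_smul, div_eq_inv_mul, mul_smul, ← smul_neg, eq_inv_smul_iff₀ hk0]
        exact eq_neg_of_add_eq_zero_left hk
      refine ⟨hk0, ?_⟩
      simpa [hk0, hne j] using hk
    · simpa [smul_eval] using congrArg (eval ![x, y]) hdep
  obtain ⟨a, b, c, d, π, cs, hd, hcs, h⟩ := hF.isCousin
  refine ⟨a, b, c, d, π, cs, hd, hcs, fun j => funext_eval_pair fun x y => ?_⟩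
  rw [map_mul, eval_C, eval_linChange_quinticForm]
  exact h j x y
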